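/- arXiv:1411.1874 — 2 statements merged into one kernel-verified Lean document; each statement's English description precedes it below -/
import Mathlib

section
/- Let E be a separable reflexive real Banach space and let X denote the closed unit ball B_E equipped with the weak topology. Then the identity map of X into E (where E carries its norm topology) is of the first Baire class: there exists a sequence of maps f_n : B_E → E, each continuous from the weak topology of B_E to the norm topology of E, such that ‖f_n(x) − x‖ → 0 for every x ∈ B_E. -/
open MeasureTheory Filter Topology

section Helpers

variable {E : Type*} [NormedAddCommGroup E] [NormedSpace ℝ E]

/-- A sequence of weakly continuous seminorm-like functions increasing to the norm. -/
lemma aux_norming [TopologicalSpace.SeparableSpace E] :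
    ∃ G : ℕ → E → ℝ, (∀ (X : Type _) [TopologicalSpace X] (h : X → E),
        (∀ τ : E →L[ℝ] ℝ, Continuous fun x => τ (h x)) → ∀ n, Continuous fun x => G n (h x)) ∧
      (∀ n y, G n y ≤ ‖y‖) ∧ ∀ y, Tendsto (fun n => G n y) atTop (𝓝 ‖y‖) := by
  choose τ hτ1 hτ2 using fun k => exists_dual_vector'' ℝ (TopologicalSpace.denseSeq E k)
  have hle : ∀ k y, τ k y ≤ ‖y‖ := fun k y =>
    (le_abs_self _).trans (by
      have := (τ k).le_of_opNorm_le (hτ1 k) y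
      simpa using this)
  refine ⟨fun n y => partialSups (fun k => τ k y) n, ?_, ?_, ?_⟩
  · intro X _ h hh n
    induction n with
    | zero => simpa using hh (τ 0)
    | succ n ih =>
      have : (fun x => partialSups (fun k => τ k (h x)) (n+1)) =
          fun x => partialSups (fun k => τ k (h x)) n ⊔ τ (n+1) (h x) := by
        funext x
        exact partialSups_add_one _ _
      simp only [this]
      exact ih.sup (hh _)
  · intro n y
    exact partialSups_le _ _ _ fun k _ => hle k y
  · intro y
    refine tendsto_order.2 ⟨fun a ha => ?_, fun a ha => ?_⟩
    · obtain ⟨k, hk⟩ := (TopologicalSpace.denseRange_denseSeq E).exists_dist_lt y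
        (ε := (‖y‖ - a) / 2) (by linarith)
      filter_upwards [eventually_ge_atTop k] with n hn
      refine lt_of_lt_of_le ?_ (le_partialSups_of_le (fun k => τ k y) hn)
      have h1 := hle k (TopologicalSpace.denseSeq E k - y)
      have h2 := hτ2 k
      rw [map_sub] at h1
      rw [dist_eq_norm] at hk
      have h3 := norm_sub_norm_le y (TopologicalSpace.denseSeq E k)
      rw [norm_sub_rev] at h1
      simp at h2
      linarith
    · exact Eventually.of_forall fun n =>
        lt_of_le_of_lt (partialSups_le _ _ _ fun k _ => hle k y) ha

lemma aux_weights (l : ℕ → ℝ) (n : ℕ) :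
    ∑ i ∈ Finset.range n, l i * ∏ j ∈ Finset.range i, (1 - l j) =
      1 - ∏ j ∈ Finset.range n, (1 - l j) := by
  induction n with
  | zero => simp
  | succ n ih => rw [Finset.sum_range_succ, ih, Finset.prod_range_succ]; ring

lemma aux_approx [TopologicalSpace.SeparableSpace E] {X : Type*} [TopologicalSpace X]
    (ι : X → E) (hι : ∀ τ : E →L[ℝ] ℝ, Continuous fun x => τ (ι x)) (ε : ℝ) (hε : 0 < ε) :
    ∃ (F : X → E) (f : ℕ → X → E), (∀ n, Continuous (f n)) ∧
      (∀ x, Tendsto (fun n => f n x) atTop (𝓝 (F x))) ∧ ∀ x, ‖F x - ι x‖ ≤ 2 * ε := by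
  obtain ⟨G, hGc, hGle, hGt⟩ := aux_norming (E := E)
  set d := TopologicalSpace.denseSeq E with hd
  let φ : ℝ → ℝ := fun t => max 0 (min 1 (2 - t / ε))
  have hφc : Continuous φ := by fun_prop
  have hφ0 : ∀ t, 0 ≤ φ t := fun t => le_max_left _ _
  have hφ1 : ∀ t, φ t ≤ 1 := fun t => max_le zero_le_one (min_le_left _ _)
  have hφe : ∀ t, t ≤ ε → φ t = 1 := fun t ht => by
    have : t / ε ≤ 1 := (div_le_one hε).2 ht
    simp only [φ]
    rw [min_eq_left (by linarith)]
    simp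
  have hφz : ∀ t, 2 * ε ≤ t → φ t = 0 := fun t ht => by
    have : 2 ≤ t / ε := (le_div_iff₀ hε).2 ht
    exact max_eq_left ((min_le_right _ _).trans (by linarith))
  let W : (ℕ → ℝ) → ℕ → ℝ := fun l i => l i * ∏ j ∈ Finset.range i, (1 - l j)
  let f : ℕ → X → E := fun n x =>
    ∑ i ∈ Finset.range n, W (fun i => φ (G n (ι x - d i))) i • d i
  have hex : ∀ x, ∃ y, Tendsto (fun n => f n x) atTop (𝓝 y) ∧ ‖y - ι x‖ ≤ 2 * ε := by
    intro x
    obtain ⟨k, hk⟩ := (TopologicalSpace.denseRange_denseSeq E).exists_dist_lt (ι x) hε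
    rw [dist_eq_norm, ← hd] at hk
    set L : ℕ → ℝ := fun i => φ ‖ι x - d i‖ with hL
    have hW0 : ∀ i, 0 ≤ W L i := fun i => mul_nonneg (hφ0 _)
      (Finset.prod_nonneg fun j _ => sub_nonneg.2 (hφ1 _))
    have hsum : ∑ i ∈ Finset.range (k+1), W L i = 1 := by
      have h := aux_weights L (k+1)
      have h2 : ∏ j ∈ Finset.range (k+1), (1 - L j) = 0 :=
        Finset.prod_eq_zero (Finset.self_mem_range_succ k) (by simp [hL, hφe _ hk.le])
      rw [h2, sub_zero] at h
      exact h
    refine ⟨∑ i ∈ Finset.range (k+1), W L i • d i, ?_, ?_⟩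
    · have h1 : Tendsto (fun n => ∑ i ∈ Finset.range (k+1),
          W (fun i => φ (G n (ι x - d i))) i • d i) atTop
          (𝓝 (∑ i ∈ Finset.range (k+1), W L i • d i)) := by
        have hl : ∀ i, Tendsto (fun n => φ (G n (ι x - d i))) atTop (𝓝 (L i)) := fun i =>
          (hφc.tendsto _).comp (hGt _)
        refine tendsto_finsetSum _ fun i _ => Tendsto.smul_const ?_ _
        exact (hl i).mul (tendsto_finsetProd _ fun j _ => (hl j).const_sub 1)
      refine h1.congr' ?_
      filter_upwards [eventually_ge_atTop (k+1)] with n hn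
      refine Finset.sum_subset (Finset.range_mono hn) fun i _ hi => ?_
      have hki : k < i := by simpa using hi
      have : W (fun i => φ (G n (ι x - d i))) i = 0 := by
        refine mul_eq_zero_of_right _ (Finset.prod_eq_zero (Finset.mem_range.2 hki) ?_)
        exact sub_eq_zero.2 (hφe _ ((hGle _ _).trans hk.le)).symm
      rw [this, zero_smul]
    · have : ∑ i ∈ Finset.range (k+1), W L i • d i - ι x =
          ∑ i ∈ Finset.range (k+1), W L i • (d i - ι x) := by
        simp only [smul_sub, Finset.sum_sub_distrib]
        rw [← Finset.sum_smul, hsum, one_smul]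
      rw [this]
      calc _ ≤ ∑ i ∈ Finset.range (k+1), W L i * (2 * ε) := by
            refine norm_sum_le_of_le _ fun i _ => ?_
            rw [norm_smul, Real.norm_of_nonneg (hW0 i), norm_sub_rev]
            rcases le_total (2 * ε) ‖ι x - d i‖ with h | h
            · have : W L i = 0 := mul_eq_zero_of_left (hφz _ h) _
              simp [this]
            · exact mul_le_mul_of_nonneg_left h (hW0 i)
        _ = 2 * ε := by rw [← Finset.sum_mul, hsum, one_mul]
  choose F hF1 hF2 using hex
  refine ⟨F, f, fun n => ?_, hF1, hF2⟩
  have hg : ∀ i, Continuous fun x => φ (G n (ι x - d i)) := fun i =>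
    hφc.comp (hGc X (fun x => ι x - d i) (fun τ => by
      simp only [map_sub]; exact (hι τ).sub continuous_const) n)
  refine continuous_finsetSum _ fun i _ => Continuous.smul ?_ continuous_const
  exact (hg i).mul (continuous_finsetProd _ fun j _ => continuous_const.sub (hg j))

lemma aux_baire [CompleteSpace E] [TopologicalSpace.SeparableSpace E] {X : Type*}
    [TopologicalSpace X]
    (ι : X → E) (hι : ∀ τ : E →L[ℝ] ℝ, Continuous fun x => τ (ι x)) :
    ∃ f : ℕ → X → E, (∀ n, Continuous (f n)) ∧
      ∀ x, Tendsto (fun n => f n x) atTop (𝓝 (ι x)) := by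
  choose F f hfc hft hF using fun m : ℕ => aux_approx ι hι ((1/2 : ℝ)^m) (by positivity)
  let r : ℕ → ℝ := fun m => 4 * (1/2 : ℝ)^m
  have hr : ∀ m, 0 < r m := fun m => by positivity
  let T : ℝ → E → E := fun r v => (r / max r ‖v‖) • v
  have hTc : ∀ m, Continuous (T (r m)) := fun m => by
    refine Continuous.smul (continuous_const.div (by fun_prop) fun v => ?_) continuous_id
    exact (lt_of_lt_of_le (hr m) (le_max_left _ _)).ne'
  have hTn : ∀ m v, ‖T (r m) v‖ ≤ r m := fun m v => by
    have hp := lt_of_lt_of_le (hr m) (le_max_left (r m) ‖v‖)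
    rw [norm_smul, Real.norm_of_nonneg (div_nonneg (hr m).le hp.le), div_mul_eq_mul_div,
      div_le_iff₀ hp]
    exact mul_le_mul_of_nonneg_left (le_max_right _ _) (hr m).le
  have hTe : ∀ m v, ‖v‖ ≤ r m → T (r m) v = v := fun m v h => by
    simp only [T]
    rw [max_eq_left h, div_self (hr m).ne', one_smul]
  have hrs : Summable r := summable_geometric_two.mul_left 4
  refine ⟨fun n x => f 0 n x + ∑ m ∈ Finset.range n, T (r m) (f (m+1) n x - f m n x),
    fun n => ?_, fun x => ?_⟩
  · exact (hfc 0 n).add (continuous_finsetSum _ fun m _ =>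
      (hTc m).comp ((hfc (m+1) n).sub (hfc m n)))
  · have hD : ∀ m, ‖F (m+1) x - F m x‖ ≤ r m := fun m => by
      have h1 := hF (m+1) x
      have h2 := hF m x
      have h3 := norm_sub_le (F (m+1) x - ι x) (F m x - ι x)
      rw [sub_sub_sub_cancel_right] at h3
      have h4 : (0:ℝ) < (1/2)^m := by positivity
      simp only [r]
      rw [pow_succ] at h1
      linarith
    have hFt : Tendsto (fun n => F n x) atTop (𝓝 (ι x)) := by
      rw [tendsto_iff_norm_sub_tendsto_zero]
      refine squeeze_zero (fun _ => norm_nonneg _) (fun n => hF n x) ?_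
      have := (tendsto_pow_atTop_nhds_zero_of_lt_one (r := (1/2:ℝ)) (by norm_num)
        (by norm_num)).const_mul 2
      simpa using this
    have hsD : Summable fun m => F (m+1) x - F m x := Summable.of_norm_bounded hrs hD
    have hts : ∑' m, (F (m+1) x - F m x) = ι x - F 0 x := by
      refine tendsto_nhds_unique hsD.hasSum.tendsto_sum_nat ?_
      simp only [Finset.sum_range_sub (fun m => F m x)]
      exact hFt.sub_const _
    have key : Tendsto (fun n => ∑' m, if m < n then T (r m) (f (m+1) n x - f m n x) else 0)
        atTop (𝓝 (∑' m, (F (m+1) x - F m x))) := by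
      refine tendsto_tsum_of_dominated_convergence hrs (fun m => ?_)
        (Eventually.of_forall fun n m => ?_)
      · have h := ((hTc m).tendsto _).comp ((hft (m+1) x).sub (hft m x))
        rw [hTe m _ (hD m)] at h
        refine h.congr' ?_
        filter_upwards [eventually_gt_atTop m] with n hn
        simp [hn]
      · split_ifs
        · exact hTn _ _
        · simpa using (hr m).le
    rw [hts] at key
    have h := (hft 0 x).add key
    rw [add_sub_cancel] at h
    refine h.congr fun n => ?_
    congr 1
    rw [tsum_eq_sum (s := Finset.range n) (fun m hm => by
      rw [if_neg (by simpa using hm)])]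
    exact Finset.sum_congr rfl fun m hm => by rw [if_pos (Finset.mem_range.1 hm)]

end Helpers

theorem statement3 (E : Type*) [NormedAddCommGroup E] [NormedSpace ℝ E] [CompleteSpace E]
    [TopologicalSpace.SeparableSpace E]
    (hrefl : Function.Bijective ⇑(NormedSpace.inclusionInDoubleDual ℝ E)) :
    ∃ f : ℕ → {x : E // ‖x‖ ≤ 1} → E,
      (∀ n, @Continuous {x : E // ‖x‖ ≤ 1} E
        (TopologicalSpace.induced (fun p : {x : E // ‖x‖ ≤ 1} => (p : E))
          (TopologicalSpace.induced (fun (x : E) => fun τ : E →L[ℝ] ℝ => τ x)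
            Pi.topologicalSpace))
        inferInstance (f n)) ∧
      ∀ x : {x : E // ‖x‖ ≤ 1},
        Tendsto (fun n => ‖f n x - (x : E)‖) atTop (𝓝 0) := by
  obtain ⟨f, hf, ht⟩ := @aux_baire E _ _ _ _ {x : E // ‖x‖ ≤ 1}
    (TopologicalSpace.induced (fun p : {x : E // ‖x‖ ≤ 1} => (p : E))
          (TopologicalSpace.induced (fun (x : E) => fun τ : E →L[ℝ] ℝ => τ x)
            Pi.topologicalSpace)) (fun p => (p : E)) (fun τ => by
      rw [induced_compose]
      letI : TopologicalSpace {x : E // ‖x‖ ≤ 1} := TopologicalSpace.induced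
        (fun (p : {x : E // ‖x‖ ≤ 1}) => fun τ : E →L[ℝ] ℝ => τ p) Pi.topologicalSpace
      have h1 : Continuous (fun (p : {x : E // ‖x‖ ≤ 1}) => fun τ : E →L[ℝ] ℝ => τ p) :=
        continuous_induced_dom
      exact (continuous_apply (A := fun _ : E →L[ℝ] ℝ => ℝ) τ).comp h1)
  exact ⟨f, hf, fun x => tendsto_iff_norm_sub_tendsto_zero.1 (ht x)⟩
end

section
/- Let 𝕜 be ℝ or ℂ, let E be a Banach space over 𝕜, let F be a vector space over 𝕜, and let f : B_E → F be a map on the closed unit ball of E which is affine (f(t·x + (1−t)·y) = t·f(x) + (1−t)·f(y) for all x, y ∈ B_E and t ∈ [0,1]) and 𝕜-homogeneous (f(α·x) = α·f(x) for every x ∈ B_E and every α ∈ 𝕜 with |α| = 1). Then there exists a unique 𝕜-linear map L : E → F such that L(x) = f(x) for every x ∈ B_E. -/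
theorem statement11 {𝕜 E F : Type*} [RCLike 𝕜]
    [NormedAddCommGroup E] [NormedSpace 𝕜 E] [CompleteSpace E]
    [AddCommGroup F] [Module 𝕜 F]
    (f : {x : E // ‖x‖ ≤ 1} → F)
    (haff : ∀ (a b c : {x : E // ‖x‖ ≤ 1}) (t : ℝ), t ∈ Set.Icc (0 : ℝ) 1 →
      (c : E) = algebraMap ℝ 𝕜 t • (a : E) + algebraMap ℝ 𝕜 (1 - t) • (b : E) →
      f c = algebraMap ℝ 𝕜 t • f a + algebraMap ℝ 𝕜 (1 - t) • f b)
    (hhom : ∀ (x y : {x : E // ‖x‖ ≤ 1}) (α : 𝕜), ‖α‖ = 1 →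
      (y : E) = α • (x : E) → f y = α • f x) :
    ∃! L : E →ₗ[𝕜] F, ∀ x : {x : E // ‖x‖ ≤ 1}, L (x : E) = f x := by
  classical
  have h0 : f ⟨0, by simp⟩ = 0 := by
    have h := hhom ⟨0, by simp⟩ ⟨0, by simp⟩ (-1) (by simp) (by simp)
    have h2 : (2 : 𝕜) • f ⟨0, by simp⟩ = 0 := by
      rw [two_smul]
      nth_rewrite 1 [h]
      simp
    exact (smul_eq_zero.mp h2).resolve_left two_ne_zero
  obtain ⟨g, hg⟩ : ∃ g : E → F, ∀ x : {x : E // ‖x‖ ≤ 1}, g x = f x :=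
    ⟨fun x => if h : ‖x‖ ≤ 1 then f ⟨x, h⟩ else 0, fun x => by simp [x.2]⟩
  have hreal : ∀ (t : ℝ) (x : E), 0 ≤ t → t ≤ 1 → ‖x‖ ≤ 1 →
      g ((t : 𝕜) • x) = (t : 𝕜) • g x := by
    intro t x ht0 ht1 hx
    have hn : ‖(t : 𝕜) • x‖ ≤ 1 := by
      rw [norm_smul, RCLike.norm_ofReal, abs_of_nonneg ht0]
      exact mul_le_one₀ ht1 (norm_nonneg _) hx
    have h := haff ⟨x, hx⟩ ⟨0, by simp⟩ ⟨_, hn⟩ t ⟨ht0, ht1⟩ (by simp)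
    rw [h0, smul_zero, add_zero] at h
    rw [hg ⟨_, hn⟩, hg ⟨x, hx⟩, h]
  have hsm : ∀ (a : 𝕜) (x : E), ‖a‖ ≤ 1 → ‖x‖ ≤ 1 → g (a • x) = a • g x := by
    intro a x ha hx
    by_cases ha0 : a = 0
    · subst ha0
      rw [zero_smul, zero_smul, hg ⟨0, by simp⟩, h0]
    have hna : ((‖a‖ : ℝ) : 𝕜) ≠ 0 := by simpa using ha0
    have hu : ‖a / ((‖a‖ : ℝ) : 𝕜)‖ = 1 := by
      rw [norm_div, RCLike.norm_ofReal, abs_norm, div_self (norm_ne_zero_iff.mpr ha0)]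
    have hux : ‖(a / ((‖a‖ : ℝ) : 𝕜)) • x‖ ≤ 1 := by rw [norm_smul, hu, one_mul]; exact hx
    have e : a = ((‖a‖ : ℝ) : 𝕜) * (a / ((‖a‖ : ℝ) : 𝕜)) := by field_simp
    have h1 := hreal ‖a‖ _ (norm_nonneg _) ha hux
    have h2 := hhom ⟨x, hx⟩ ⟨_, hux⟩ _ hu rfl
    rw [← hg, ← hg] at h2
    rw [h2, smul_smul, smul_smul, ← e] at h1
    exact h1
  have hball : ∀ (c : 𝕜) (x : E), ‖x‖ ≤ ‖c‖ → ‖c⁻¹ • x‖ ≤ 1 := by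
    intro c x h
    rw [norm_smul, norm_inv, inv_mul_eq_div]
    exact div_le_one_of_le₀ h (norm_nonneg _)
  have key0 : ∀ (c d : 𝕜) (x : E), c ≠ 0 → d ≠ 0 → ‖x‖ ≤ ‖c‖ → ‖c‖ ≤ ‖d‖ →
      d • g (d⁻¹ • x) = c • g (c⁻¹ • x) := by
    intro c d x hc hd hx hcd
    have e : d⁻¹ • x = (c / d) • (c⁻¹ • x) := by
      rw [smul_smul]; congr 1; field_simp
    rw [e, hsm _ _ (by rw [norm_div]; exact div_le_one_of_le₀ hcd (norm_nonneg _))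
      (hball c x hx), smul_smul, mul_div_cancel₀ _ hd]
  have key : ∀ (c d : 𝕜) (x : E), c ≠ 0 → d ≠ 0 → ‖x‖ ≤ ‖c‖ → ‖x‖ ≤ ‖d‖ →
      d • g (d⁻¹ • x) = c • g (c⁻¹ • x) := by
    intro c d x hc hd hxc hxd
    rcases le_total ‖c‖ ‖d‖ with h | h
    · exact key0 c d x hc hd hxc h
    · exact (key0 d c x hd hc hxd h).symm
  have hN : ∀ r : ℝ, 0 < r → ((r : 𝕜) ≠ 0 ∧ ‖(r : 𝕜)‖ = r) := by
    intro r hr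
    exact ⟨by exact_mod_cast hr.ne', by rw [RCLike.norm_ofReal, abs_of_pos hr]⟩
  obtain ⟨N, hNdef⟩ : ∃ N : E → 𝕜, ∀ x, N x = ((1 + ‖x‖ : ℝ) : 𝕜) := ⟨_, fun _ => rfl⟩
  have hN0 : ∀ x, N x ≠ 0 := fun x => by
    rw [hNdef]; exact (hN _ (by positivity)).1
  have hN1 : ∀ x, ‖N x‖ = 1 + ‖x‖ := fun x => by
    rw [hNdef]; exact (hN _ (by positivity)).2
  have hNx : ∀ x, ‖x‖ ≤ ‖N x‖ := fun x => by rw [hN1]; linarith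
  let L : E →ₗ[𝕜] F :=
    { toFun := fun x => N x • g ((N x)⁻¹ • x)
      map_add' := by
        intro x y
        obtain ⟨hr0, hr1⟩ := hN (1 + ‖x‖ + ‖y‖) (by positivity)
        generalize ((1 + ‖x‖ + ‖y‖ : ℝ) : 𝕜) = r at hr0 hr1
        have hx : ‖x‖ ≤ ‖r‖ := by rw [hr1]; linarith [norm_nonneg y]
        have hy : ‖y‖ ≤ ‖r‖ := by rw [hr1]; linarith [norm_nonneg x]
        have hxy : ‖x + y‖ ≤ ‖2 * r‖ := by
          rw [norm_mul, RCLike.norm_two]; linarith [norm_add_le x y]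
        have h2r : 2 * r ≠ 0 := mul_ne_zero two_ne_zero hr0
        rw [key r _ x hr0 (hN0 x) hx (hNx x), key r _ y hr0 (hN0 y) hy (hNx y),
          key (2 * r) _ (x + y) h2r (hN0 _) hxy (hNx _)]
        have e2 : algebraMap ℝ 𝕜 2 = 2 := map_ofNat _ 2
        have h := haff ⟨_, hball _ _ hx⟩ ⟨_, hball _ _ hy⟩ ⟨_, hball _ _ hxy⟩ (1 / 2)
          ⟨by norm_num, by norm_num⟩ (by
            have e1 : (1 - 1 / 2 : ℝ) = 1 / 2 := by norm_num
            rw [e1, ← smul_add, ← smul_add, smul_smul]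
            congr 1
            simp [mul_comm, e2])
        have e1 : (1 - 1 / 2 : ℝ) = 1 / 2 := by norm_num
        rw [e1, ← smul_add, ← hg, ← hg, ← hg] at h
        simp only at h
        rw [h, smul_smul, ← smul_add]
        congr 1
        rw [map_div₀, map_one, e2]
        field_simp
      map_smul' := by
        intro a x
        obtain ⟨hr0, hr1⟩ := hN (1 + ‖a‖) (by positivity)
        generalize ((1 + ‖a‖ : ℝ) : 𝕜) = r at hr0 hr1
        have har : ‖a‖ ≤ ‖r‖ := by rw [hr1]; linarith
        have hax : ‖a • x‖ ≤ ‖r * N x‖ := by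
          rw [norm_smul, norm_mul]
          exact mul_le_mul har (hNx x) (norm_nonneg _) (norm_nonneg _)
        rw [key (r * N x) _ (a • x) (mul_ne_zero hr0 (hN0 x)) (hN0 _) hax (hNx _)]
        have hn := hN0 x
        have e : (r * N x)⁻¹ • a • x = (a / r) • ((N x)⁻¹ • x) := by
          rw [smul_smul, smul_smul]; congr 1; field_simp
        rw [e, hsm _ _ (by rw [norm_div]; exact div_le_one_of_le₀ har (norm_nonneg _))
          (hball _ x (hNx x)), smul_smul, RingHom.id_apply, smul_smul]
        congr 1
        field_simp }
  refine ⟨L, ?_, ?_⟩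
  · intro x
    change N (x : E) • g ((N (x : E))⁻¹ • (x : E)) = f x
    rw [key 1 _ x one_ne_zero (hN0 _) (by simpa using x.2) (hNx _)]
    simp [hg]
  · intro L' hL'
    ext x
    change L' x = N x • g ((N x)⁻¹ • x)
    have h := hL' ⟨_, hball _ x (hNx x)⟩
    rw [← hg] at h
    simp only at h
    rw [← h, map_smul, smul_smul, mul_inv_cancel₀ (hN0 x), one_smul]
end
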